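/- arXiv:1211.5477 — 4 statements merged into one kernel-verified Lean document; each statement's English description precedes it below -/
import Mathlib

section
/- (Conformal double-bracket formula on g₋₁.) For every row covector Z ∈ (ℝⁿ)* and all column vectors X, Y ∈ ℝⁿ, ⁅⁅ι₊(Z), ι₋(X)⁆, ι₋(Y)⁆ = ι₋(−(Z⬝Y)X − (Z⬝X)Y + ⟨X,Y⟩ IZᵀ), where IZᵀ is the column vector obtained from Z. -/
open Matrix

/-- Index type for (n+2)×(n+2) block matrices with blocks of sizes 1, n, 1. -/
abbrev Idx (n : ℕ) := Unit ⊕ Fin n ⊕ Unit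

/-- The diagonal entries of the signature matrix I = diag(Id_p, −Id_q). -/
def sig (p q : ℕ) : Fin (p + q) → ℝ := fun i => if (i : ℕ) < p then 1 else -1

/-- The n×n signature matrix I = diag(Id_p, −Id_q). -/
def sigMat (p q : ℕ) : Matrix (Fin (p + q)) (Fin (p + q)) ℝ := Matrix.diagonal (sig p q)

/-- The inner product of signature (p,q): ⟨X,Y⟩ = Xᵀ I Y (the same formula gives
Z I Wᵀ for row covectors). -/
def form (p q : ℕ) (X Y : Fin (p + q) → ℝ) : ℝ := ∑ i, X i * sig p q i * Y i

/-- The column vector I Zᵀ associated to a row covector Z (written `starr`) (equally, the row covector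
Xᵀ I associated to a column vector X). -/
def iFlip (p q : ℕ) (Z : Fin (p + q) → ℝ) : Fin (p + q) → ℝ := fun i => sig p q i * Z i

/-- Embedding of g₋₁ ≅ ℝⁿ into so(p+1,q+1): (2,1)-block X, (3,2)-block −XᵀI. -/
def iotaMinus (p q : ℕ) (X : Fin (p + q) → ℝ) : Matrix (Idx (p + q)) (Idx (p + q)) ℝ :=
  Matrix.of fun i j =>
    match i, j with
    | Sum.inr (Sum.inl i), Sum.inl _ => X i
    | Sum.inr (Sum.inr _), Sum.inr (Sum.inl j) => -(X j * sig p q j)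
    | _, _ => 0

/-- Embedding of g₁ ≅ (ℝⁿ)* into so(p+1,q+1): (1,2)-block Z, (2,3)-block −IZᵀ. -/
def iotaPlus (p q : ℕ) (Z : Fin (p + q) → ℝ) : Matrix (Idx (p + q)) (Idx (p + q)) ℝ :=
  Matrix.of fun i j =>
    match i, j with
    | Sum.inl _, Sum.inr (Sum.inl j) => Z j
    | Sum.inr (Sum.inl i), Sum.inr (Sum.inr _) => -(sig p q i * Z i)
    | _, _ => 0

/-- Embedding of g₀ into so(p+1,q+1): block diagonal matrix diag(a, A, −a). -/
def iotaZero (p q : ℕ) (A : Matrix (Fin (p + q)) (Fin (p + q)) ℝ) (a : ℝ) :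
    Matrix (Idx (p + q)) (Idx (p + q)) ℝ :=
  Matrix.of fun i j =>
    match i, j with
    | Sum.inl _, Sum.inl _ => a
    | Sum.inr (Sum.inl i), Sum.inr (Sum.inl j) => A i j
    | Sum.inr (Sum.inr _), Sum.inr (Sum.inr _) => -a
    | _, _ => 0

theorem sig_mul_self (p q : ℕ) (i : Fin (p + q)) : sig p q i * sig p q i = 1 := by
  unfold sig
  split_ifs <;> norm_num

/-- The bracket g₁ × g₋₁ → g₀. -/
theorem lie_iotaPlus_iotaMinus (p q : ℕ) (Z X : Fin (p + q) → ℝ) :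
    ⁅iotaPlus p q Z, iotaMinus p q X⁆ =
      iotaZero p q (vecMulVec (iFlip p q Z) (iFlip p q X) - vecMulVec X Z)
        (∑ i, Z i * X i) := by
  ext i j
  rcases i with _ | i | _ <;> rcases j with _ | j | _ <;>
    simp [Ring.lie_def, Matrix.mul_apply, iotaPlus, iotaMinus, iotaZero, iFlip, vecMulVec_apply]
  · simp [mul_comm]
  · refine Finset.sum_congr rfl fun i _ => ?_
    linear_combination X i * Z i * sig_mul_self p q i

/-- Conformal double-bracket formula on g₋₁:
⁅⁅ι₊(Z), ι₋(X)⁆, ι₋(Y)⁆ = ι₋(−(Z⬝Y)X − (Z⬝X)Y + ⟨X,Y⟩ IZᵀ). -/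
theorem conformal_double_bracket_minus (p q : ℕ) (hn : 3 ≤ p + q) (Z X Y : Fin (p + q) → ℝ) :
    ⁅⁅iotaPlus p q Z, iotaMinus p q X⁆, iotaMinus p q Y⁆ =
      iotaMinus p q (-((∑ i, Z i * Y i) • X) - (∑ i, Z i * X i) • Y
        + form p q X Y • iFlip p q Z) := by
  rw [lie_iotaPlus_iotaMinus]
  ext i j
  rcases i with _ | i | _ <;> rcases j with _ | j | _ <;>
    simp [Ring.lie_def, Matrix.mul_apply, iotaMinus, iotaZero, iFlip, vecMulVec_apply, form,
      sub_mul, mul_sub, Finset.sum_sub_distrib]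
  · have h₁ : ∑ k, sig p q i * Z i * (sig p q k * X k) * Y k =
        (∑ k, X k * sig p q k * Y k) * (sig p q i * Z i) := by
      rw [Finset.sum_mul]
      exact Finset.sum_congr rfl fun k _ => by ring
    have h₂ : ∑ k, X i * Z k * Y k = (∑ k, Z k * Y k) * X i := by
      rw [Finset.sum_mul]
      exact Finset.sum_congr rfl fun k _ => by ring
    rw [h₁, h₂]
    ring
  · have h₁ : ∑ k, Y k * sig p q k * (sig p q k * Z k * (sig p q j * X j)) =
        (∑ k, Z k * Y k) * (sig p q j * X j) := by
      rw [Finset.sum_mul]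
      refine Finset.sum_congr rfl fun k _ => ?_
      linear_combination Y k * Z k * sig p q j * X j * sig_mul_self p q k
    have h₂ : ∑ k, Y k * sig p q k * (X k * Z j) = (∑ k, X k * sig p q k * Y k) * Z j := by
      rw [Finset.sum_mul]
      exact Finset.sum_congr rfl fun k _ => by ring
    rw [Finset.sum_add_distrib, Finset.sum_neg_distrib, h₁, h₂]
    linear_combination (∑ k, X k * sig p q k * Y k) * Z j * sig_mul_self p q j
end

section
/- (Conformal non-null case, C(Z) = 0.) Let Z ∈ (ℝⁿ)* be a row covector with ⟨Z,Z⟩ ≠ 0. If a column vector X ∈ ℝⁿ satisfies ⁅ι₋(X), ι₊(Z)⁆ = 0, then X = 0. -/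
open Matrix

/-- The upper-left entry of `⁅ι₋(X), ι₊(Z)⁆` is `-(Z⬝X)`. -/
theorem lie_iotaMinus_iotaPlus_inl_inl (p q : ℕ) (X Z : Fin (p + q) → ℝ) :
    ⁅iotaMinus p q X, iotaPlus p q Z⁆ (Sum.inl ()) (Sum.inl ()) = -∑ k, Z k * X k := by
  simp [Ring.lie_def, Matrix.mul_apply, iotaMinus, iotaPlus]

/-- The middle block of `⁅ι₋(X), ι₊(Z)⁆` is `X⊗Z - (IZᵀ)⊗(XᵀI)`. -/
theorem lie_iotaMinus_iotaPlus_inr_inl (p q : ℕ) (X Z : Fin (p + q) → ℝ) (i j : Fin (p + q)) :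
    ⁅iotaMinus p q X, iotaPlus p q Z⁆ (Sum.inr (Sum.inl i)) (Sum.inr (Sum.inl j)) =
      X i * Z j - sig p q i * Z i * (X j * sig p q j) := by
  simp [Ring.lie_def, Matrix.mul_apply, iotaMinus, iotaPlus]

/-- Conformal non-null case, C(Z) = 0: if ⟨Z,Z⟩ ≠ 0 and
⁅ι₋(X), ι₊(Z)⁆ = 0, then X = 0. -/
theorem conformal_nonnull_CZ (p q : ℕ) (hn : 3 ≤ p + q) (Z : Fin (p + q) → ℝ)
    (hZ : form p q Z Z ≠ 0) (X : Fin (p + q) → ℝ)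
    (h : ⁅iotaMinus p q X, iotaPlus p q Z⁆ = 0) : X = 0 := by
  have hZX : ∑ k, Z k * X k = 0 := by
    have h0 := lie_iotaMinus_iotaPlus_inl_inl p q X Z
    rw [h] at h0
    simpa using h0.symm
  have hij (i j : Fin (p + q)) : X i * Z j = sig p q i * Z i * (X j * sig p q j) := by
    have h0 := lie_iotaMinus_iotaPlus_inr_inl p q X Z i j
    rw [h] at h0
    exact sub_eq_zero.mp h0.symm
  funext i
  have key : X i * form p q Z Z = sig p q i * Z i * ∑ k, Z k * X k := by
    rw [form, Finset.mul_sum, Finset.mul_sum]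
    refine Finset.sum_congr rfl fun j _ => ?_
    linear_combination sig p q j * Z j * hij i j +
      sig p q i * Z i * X j * Z j * sig_mul_self p q j
  rw [hZX, mul_zero] at key
  exact (mul_eq_zero.mp key).resolve_right hZ
end

section
/- (Conformal non-null case, description of F(Z).) Let Z ∈ (ℝⁿ)* be a row covector with ⟨Z,Z⟩ ≠ 0. A column vector X ∈ ℝⁿ satisfies ⁅ι₋(X), ⁅ι₋(X), ι₊(Z)⁆⁆ = 0 if and only if Z⬝X = 0 and ⟨X,X⟩ = 0. -/
open Matrix

theorem iotaMinus_eq_zero_iff (p q : ℕ) (X : Fin (p + q) → ℝ) :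
    iotaMinus p q X = 0 ↔ ∀ i, X i = 0 := by
  constructor
  · intro h i
    simpa [iotaMinus] using congrFun (congrFun h (Sum.inr (Sum.inl i))) (Sum.inl ())
  · intro h
    ext i j
    rcases i with i | i | i <;> rcases j with j | j | j <;> simp [iotaMinus, h]

theorem lie_iotaMinus_iotaPlus (p q : ℕ) (X Z : Fin (p + q) → ℝ) :
    ⁅iotaMinus p q X, iotaPlus p q Z⁆ =
      iotaZero p q (vecMulVec X Z - vecMulVec (iFlip p q Z) (iFlip p q X))
        (-∑ i, Z i * X i) := by
  have key : ∀ i, X i * sig p q i * (sig p q i * Z i) = Z i * X i := fun i => by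
    linear_combination (X i * Z i) * sig_mul_self p q i
  ext i j
  rcases i with i | i | i <;> rcases j with j | j | j <;>
    simp [Ring.lie_def, Matrix.mul_apply, iotaMinus, iotaPlus, iotaZero, vecMulVec_apply, iFlip,
      mul_comm (X _) (sig p q _)]
  simp [mul_comm (sig p q _) (X _), key]

/-- The bracket of `g₋₁` with `g₀`, for `A` skew with respect to the form. -/
theorem lie_iotaMinus_iotaZero (p q : ℕ) (X : Fin (p + q) → ℝ)
    (A : Matrix (Fin (p + q)) (Fin (p + q)) ℝ) (a : ℝ)
    (hA : ∀ i j, sig p q i * A i j = -(A j i * sig p q j)) :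
    ⁅iotaMinus p q X, iotaZero p q A a⁆ = iotaMinus p q (a • X - A *ᵥ X) := by
  have key : ∀ i j, X i * sig p q i * A i j = -(A j i * X i * sig p q j) := fun i j => by
    linear_combination X i * hA i j
  ext i j
  rcases i with i | i | i <;> rcases j with j | j | j <;>
    simp [Ring.lie_def, Matrix.mul_apply, iotaMinus, iotaZero, mulVec, dotProduct, key]
  · ring
  · rw [← Finset.sum_mul]
    ring

theorem lie_iotaMinus_lie_iotaMinus_iotaPlus (p q : ℕ) (X Z : Fin (p + q) → ℝ) :
    ⁅iotaMinus p q X, ⁅iotaMinus p q X, iotaPlus p q Z⁆⁆ =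
      iotaMinus p q (form p q X X • iFlip p q Z - (2 * ∑ i, Z i * X i) • X) := by
  rw [lie_iotaMinus_iotaPlus, lie_iotaMinus_iotaZero]
  · congr 1
    have hf : iFlip p q X ⬝ᵥ X = form p q X X := by
      simp [dotProduct, iFlip, form, mul_comm (sig p q _)]
    have hz : Z ⬝ᵥ X = ∑ i, Z i * X i := rfl
    ext i
    simp [sub_mulVec, vecMulVec_mulVec, hf, hz]
    ring
  · intro i j
    simp only [Matrix.sub_apply, vecMulVec_apply, iFlip]
    linear_combination (-Z i * sig p q j * X j) * sig_mul_self p q i -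
      X i * sig p q i * Z j * sig_mul_self p q j

/-- Conformal non-null case, description of F(Z): for ⟨Z,Z⟩ ≠ 0,
⁅ι₋(X), ⁅ι₋(X), ι₊(Z)⁆⁆ = 0 iff Z⬝X = 0 and ⟨X,X⟩ = 0. -/
theorem conformal_nonnull_FZ (p q : ℕ) (hn : 3 ≤ p + q) (Z : Fin (p + q) → ℝ)
    (hZ : form p q Z Z ≠ 0) (X : Fin (p + q) → ℝ) :
    ⁅iotaMinus p q X, ⁅iotaMinus p q X, iotaPlus p q Z⁆⁆ = 0 ↔
      (∑ i, Z i * X i) = 0 ∧ form p q X X = 0 := by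
  rw [lie_iotaMinus_lie_iotaMinus_iotaPlus, iotaMinus_eq_zero_iff]
  constructor
  · intro h
    simp only [Pi.sub_apply, Pi.smul_apply, smul_eq_mul, iFlip] at h
    set s := ∑ i, Z i * X i with hs
    set f := form p q X X with hf
    have hZZ : f * form p q Z Z = 2 * s * s := by
      conv_rhs => rw [hs, Finset.mul_sum]
      rw [form, Finset.mul_sum]
      exact Finset.sum_congr rfl fun i _ => by linear_combination Z i * h i
    have hXX : f * s = 2 * s * f := by
      conv_lhs => rw [hs, Finset.mul_sum]
      conv_rhs => rw [hf, form, Finset.mul_sum]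
      refine Finset.sum_congr rfl fun i _ => ?_
      linear_combination X i * sig p q i * h i - f * Z i * X i * sig_mul_self p q i
    rcases mul_eq_zero.mp (show s * f = 0 by linear_combination -hXX) with h0 | h0
    · refine ⟨h0, ?_⟩
      rw [h0] at hZZ
      simpa [hZ] using hZZ
    · refine ⟨?_, h0⟩
      rw [h0] at hZZ
      simpa using hZZ.symm
  · rintro ⟨hs, hf⟩ i
    simp [hs, hf]
end

section
/- (Conformal null case, description of C(Z).) Let Z ∈ (ℝⁿ)* be a nonzero row covector with ⟨Z,Z⟩ = 0. A column vector X ∈ ℝⁿ satisfies ⁅ι₋(X), ι₊(Z)⁆ = 0 if and only if X is a real scalar multiple of IZᵀ. -/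
open Matrix

theorem iotaZero_eq_zero_iff (p q : ℕ) (A : Matrix (Fin (p + q)) (Fin (p + q)) ℝ) (a : ℝ) :
    iotaZero p q A a = 0 ↔ A = 0 ∧ a = 0 := by
  constructor
  · refine fun h => ⟨?_, congrFun (congrFun h (Sum.inl ())) (Sum.inl ())⟩
    ext i j
    exact congrFun (congrFun h (Sum.inr (Sum.inl i))) (Sum.inr (Sum.inl j))
  · rintro ⟨rfl, rfl⟩
    ext (_ | i | _) (_ | j | _) <;> simp [iotaZero]

/-- Conformal null case, description of C(Z): for Z ≠ 0 with ⟨Z,Z⟩ = 0,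
⁅ι₋(X), ι₊(Z)⁆ = 0 iff X is a scalar multiple of IZᵀ. -/
theorem conformal_null_CZ (p q : ℕ) (hn : 3 ≤ p + q) (Z : Fin (p + q) → ℝ)
    (hZ : Z ≠ 0) (hnull : form p q Z Z = 0) (X : Fin (p + q) → ℝ) :
    ⁅iotaMinus p q X, iotaPlus p q Z⁆ = 0 ↔ ∃ c : ℝ, X = c • iFlip p q Z := by
  rw [lie_iotaMinus_iotaPlus, iotaZero_eq_zero_iff]
  constructor
  · rintro ⟨h, -⟩
    obtain ⟨k, hk⟩ := Function.ne_iff.mp hZ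
    refine ⟨iFlip p q X k / Z k, funext fun i => ?_⟩
    have hik : X i * Z k = iFlip p q Z i * iFlip p q X k := by
      simpa [vecMulVec_apply, sub_eq_zero] using congrFun (congrFun h i) k
    rw [Pi.smul_apply, smul_eq_mul, div_mul_eq_mul_div, eq_div_iff hk, hik, mul_comm]
  · rintro ⟨c, rfl⟩
    constructor
    · ext i j
      simp only [Matrix.sub_apply, vecMulVec_apply, Pi.smul_apply, smul_eq_mul, iFlip,
        Matrix.zero_apply]
      linear_combination (-c * sig p q i * Z i * Z j) * sig_mul_self p q j
    · rw [neg_eq_zero, ← mul_zero c, ← hnull, form, Finset.mul_sum]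
      refine Finset.sum_congr rfl fun i _ => ?_
      simp only [Pi.smul_apply, smul_eq_mul, iFlip]
      ring
end
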